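/- Let (E,H,(·|·)) and (E,H',(·|·)') be two extended affine Lie algebra structures on the same Lie algebra E over an algebraically closed field k of characteristic 0; their cores coincide, E_c = E'_c. Put H_c = H ∩ E_c and H'_c = H' ∩ E_c, and let H_cc and H'_cc denote the images of H_c and H'_c under the quotient map E_c → E_c/Z(E_c). If H_cc = H'_cc, then: (a) H_c = H'_c; and (b) there exists a Lie algebra automorphism f of E that fixes E_c pointwise and satisfies f(H) = H'. -/

import Mathlib

/-! Statement 18: conjugacy of Cartan subalgebras with equal image in the centreless core. -/

section EALA

variable {k E : Type*} [Field k] [CharZero k] [LieRing E] [LieAlgebra k E]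

/-- The weight space of the toral subalgebra `H` for the weight `α ∈ H*`:
`E_α = {e ∈ E : [h,e] = α(h)e for all h ∈ H}`. -/
def wtSpace (H : LieSubalgebra k E) (α : Module.Dual k H) : Submodule k E where
  carrier := {e | ∀ h : H, ⁅(h : E), e⁆ = α h • e}
  add_mem' := by
    intro a b ha hb h
    simp only [lie_add, ha h, hb h, smul_add]
  zero_mem' := by
    intro h
    simp
  smul_mem' := by
    intro c a ha h
    rw [lie_smul, ha h, smul_comm]

/-- The set of roots `Ψ` of `(E,H)`: those `α ∈ H*` with `E_α ≠ 0` (note `0 ∈ Ψ`). -/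
def rootSet (H : LieSubalgebra k E) : Set (Module.Dual k H) :=
  {α | wtSpace H α ≠ ⊥}

variable (B : E →ₗ[k] E →ₗ[k] k)

/-- The representatives `t_α ∈ H` of `α ∈ H*` under the form: `(t_α | h) = α(h)` for `h ∈ H`. -/
def reps (H : LieSubalgebra k E) (α : Module.Dual k H) : Set H :=
  {t | ∀ h : H, B (t : E) (h : E) = α h}

/-- The anisotropic roots: `Ψ^an = {α ∈ Ψ : (α|α) ≠ 0}`. -/
def anisoRootSet (H : LieSubalgebra k E) : Set (Module.Dual k H) :=
  {α | α ∈ rootSet H ∧ ∃ t ∈ reps B H α, B (t : E) (t : E) ≠ 0}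

/-- The isotropic (null) roots: `Ψ⁰ = {α ∈ Ψ : (α|α) = 0}`. -/
def isoRootSet (H : LieSubalgebra k E) : Set (Module.Dual k H) :=
  {α | α ∈ rootSet H ∧ ∃ t ∈ reps B H α, B (t : E) (t : E) = 0}

/-- The core `E_c` of `(E, H, (·|·))`: the subalgebra of `E` generated by
`⋃_{α ∈ Ψ^an} E_α`. -/
def core (H : LieSubalgebra k E) : LieSubalgebra k E :=
  LieSubalgebra.lieSpan k E (⋃ α ∈ anisoRootSet B H, (wtSpace H α : Set E))

/-- An extended affine Lie algebra structure `(E, H, (·|·))` (paper §2.3):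
axioms (EA1)–(EA5), together with the requirements that the bilinear form is
nondegenerate, symmetric and invariant. -/
structure IsEALA (H : LieSubalgebra k E) : Prop where
  /-- the form is symmetric -/
  symm : ∀ x y : E, B x y = B y x
  /-- the form is invariant -/
  invariant : ∀ x y z : E, B ⁅x, y⁆ z = B x ⁅y, z⁆
  /-- the form is nondegenerate -/
  nondeg : ∀ x : E, (∀ y : E, B x y = 0) → x = 0
  /-- (EA1): `H` is nontrivial … -/
  H_ne_bot : H ≠ ⊥
  /-- … finite-dimensional … -/
  H_fd : FiniteDimensional k H
  /-- … self-centralizing (in particular abelian): `E_0 = H` … -/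
  self_centralizing : wtSpace H 0 = H.toSubmodule
  /-- … and toral: `E = ⊕_{α ∈ H*} E_α` -/
  toral : (⨆ α : Module.Dual k H, wtSpace H α) = ⊤
  /-- the restriction of the form to `H × H` is nondegenerate -/
  H_nondeg : ∀ t : H, (∀ h : H, B (t : E) (h : E) = 0) → t = 0
  /-- (EA2): `ad x` is locally nilpotent for `x ∈ E_α`, `α ∈ Ψ^an` -/
  ea2 : ∀ α ∈ anisoRootSet B H, ∀ x ∈ wtSpace H α, ∀ e : E,
    ∃ N : ℕ, (fun y => ⁅x, y⁆)^[N] e = 0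
  /-- (EA3): `Ψ^an` is connected -/
  ea3 : ∀ Ψ₁ Ψ₂ : Set (Module.Dual k H), anisoRootSet B H = Ψ₁ ∪ Ψ₂ →
    Ψ₁.Nonempty → Ψ₂.Nonempty →
    ∃ α ∈ Ψ₁, ∃ β ∈ Ψ₂, ∃ t ∈ reps B H α, ∃ s ∈ reps B H β, B (t : E) (s : E) ≠ 0
  /-- (EA4): the centralizer of the core is contained in the core -/
  ea4 : ∀ e : E, (∀ x ∈ core B H, ⁅e, x⁆ = 0) → e ∈ core B H
  /-- (EA5): the subgroup of `(H*,+)` generated by `Ψ⁰` is free abelian of finite rank -/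
  ea5 : ∃ n : ℕ, Nonempty ((AddSubgroup.closure (isoRootSet B H)) ≃+ (Fin n → ℤ))

end EALA


section WeightSpaces

variable {k E : Type*} [Field k] [LieRing E] [LieAlgebra k E] {H : LieSubalgebra k E}

theorem lie_mem_wtSpace {α β : Module.Dual k H} {x y : E}
    (hx : x ∈ wtSpace H α) (hy : y ∈ wtSpace H β) : ⁅x, y⁆ ∈ wtSpace H (α + β) := by
  intro h
  rw [leibniz_lie, hx h, hy h, smul_lie, lie_smul, LinearMap.add_apply, add_smul]

theorem iterate_lie_mem_wtSpace {α β : Module.Dual k H} {x y : E}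
    (hx : x ∈ wtSpace H α) (hy : y ∈ wtSpace H β) (n : ℕ) :
    (fun w => ⁅x, w⁆)^[n] y ∈ wtSpace H (β + n • α) := by
  induction n with
  | zero => simpa using hy
  | succ n ih =>
    rw [Function.iterate_succ_apply']
    have := lie_mem_wtSpace hx ih
    rwa [show α + (β + n • α) = β + (n + 1) • α by rw [succ_nsmul]; abel] at this

theorem iSupIndep_wtSpace (hab : ∀ x y : H, ⁅(x : E), (y : E)⁆ = 0) :
    iSupIndep (wtSpace H) := by
  have hc : ∀ i j : H, Commute (LieAlgebra.ad k E (i : E)) (LieAlgebra.ad k E (j : E)) := by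
    intro i j
    refine LinearMap.ext fun x => ?_
    change ⁅(i : E), ⁅(j : E), x⁆⁆ = ⁅(j : E), ⁅(i : E), x⁆⁆
    rw [leibniz_lie, hab, zero_lie, zero_add]
  have key := Module.End.independent_iInf_maxGenEigenspace_of_forall_mapsTo
    (fun i : H => LieAlgebra.ad k E (i : E))
    (fun i j φ => Module.End.mapsTo_maxGenEigenspace_of_comm (hc j i) φ)
  refine (key.comp (f := fun α : Module.Dual k H => (α : H → k))
    DFunLike.coe_injective).mono fun α x hx => ?_
  simp only [Function.comp, Submodule.mem_iInf]
  intro i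
  refine (Module.End.genEigenspace _ _).mono (show (1 : ℕ∞) ≤ ⊤ from le_top) ?_
  exact Module.End.mem_eigenspace_iff.mpr (hx i)

/-- Projections onto the weight spaces of an abelian subalgebra acting diagonalizably. -/
theorem exists_wtSpace_proj (hab : ∀ x y : H, ⁅(x : E), (y : E)⁆ = 0)
    (htop : (⨆ α : Module.Dual k H, wtSpace H α) = ⊤) :
    ∃ p : Module.Dual k H → E →ₗ[k] E,
      (∀ α x, p α x ∈ wtSpace H α) ∧ (∀ α, ∀ x ∈ wtSpace H α, p α x = x) ∧
      (∀ α β, α ≠ β → ∀ x ∈ wtSpace H α, p β x = 0) ∧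
      (∀ x, ∃ s : Finset (Module.Dual k H), (∀ α, α ∈ s ↔ p α x ≠ 0) ∧ ∑ α ∈ s, p α x = x) := by
  classical
  have hinternal : DirectSum.IsInternal (wtSpace H) :=
    DirectSum.isInternal_submodule_of_iSupIndep_of_iSup_eq_top (iSupIndep_wtSpace hab) htop
  let _ := hinternal.chooseDecomposition
  refine ⟨fun α => (wtSpace H α).subtype ∘ₗ DirectSum.component k _ _ α ∘ₗ
    (DirectSum.decomposeLinearEquiv (wtSpace H)).toLinearMap, ?_, ?_, ?_, ?_⟩
  · intro α x
    exact Subtype.property _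
  · intro α x hx
    exact DirectSum.decompose_of_mem_same _ hx
  · intro α β hαβ x hx
    exact DirectSum.decompose_of_mem_ne _ hx hαβ
  · intro x
    refine ⟨(DirectSum.decompose (wtSpace H) x).support, fun α => ?_,
      DirectSum.sum_support_decompose _ x⟩
    rw [DFinsupp.mem_support_iff]
    exact (ZeroMemClass.coe_eq_zero (S' := wtSpace H α)).not.symm

end WeightSpaces

theorem IsSl2Triple.HasPrimitiveVectorWith.exists_nat_of_iterate_eq_zero
    {k E : Type*} [Field k] [CharZero k] [LieRing E] [LieAlgebra k E] {h e f v : E} {μ : k}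
    {t : IsSl2Triple h e f} (P : t.HasPrimitiveVectorWith v μ)
    (hN : ∃ N : ℕ, (fun y => ⁅f, y⁆)^[N] v = 0) : ∃ n : ℕ, μ = n := by
  have hN' : ∃ N : ℕ, ((LieModule.toEnd k E E f) ^ N) v = 0 := by
    obtain ⟨N, hN⟩ := hN
    refine ⟨N, ?_⟩
    rw [Module.End.pow_apply]
    exact hN
  obtain ⟨n, hn₁, hn₂⟩ := Nat.exists_not_and_succ_of_not_zero_of_exists
    (p := fun N => ((LieModule.toEnd k E E f) ^ N) v = 0) P.ne_zero hN'
  refine ⟨n, ?_⟩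
  have := P.lie_e_pow_succ_toEnd_f n
  rw [hn₂, lie_zero, eq_comm, smul_eq_zero_iff_left hn₁, mul_eq_zero, sub_eq_zero] at this
  exact this.resolve_left <| Nat.cast_add_one_ne_zero n

/-- If `⁅e, f⁆ = t` commutes with `f` and acts on `w` by `c ≠ 0`, while `⁅e, w⁆ = 0`, then no
power of `ad f` kills `w`. -/
theorem iterate_lie_ne_zero_of_heisenberg
    {k E : Type*} [Field k] [CharZero k] [LieRing E] [LieAlgebra k E] {e f t w : E} {c : k}
    (hef : ⁅e, f⁆ = t) (htf : ⁅t, f⁆ = 0) (hc : c ≠ 0) (htw : ⁅t, w⁆ = c • w)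
    (hew : ⁅e, w⁆ = 0) (hw : w ≠ 0) (n : ℕ) : (fun y => ⁅f, y⁆)^[n] w ≠ 0 := by
  have ht : ∀ n : ℕ, ⁅t, (fun y => ⁅f, y⁆)^[n] w⁆ = c • (fun y => ⁅f, y⁆)^[n] w := by
    intro n
    induction n with
    | zero => exact htw
    | succ n ih =>
      rw [Function.iterate_succ_apply', leibniz_lie, htf, ih]
      simp
  have he : ∀ n : ℕ, ⁅e, (fun y => ⁅f, y⁆)^[n + 1] w⁆
      = (((n + 1 : ℕ) : k) * c) • (fun y => ⁅f, y⁆)^[n] w := by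
    intro n
    induction n with
    | zero => simp [leibniz_lie e, hef, hew, htw]
    | succ n ih =>
      rw [Function.iterate_succ_apply', leibniz_lie, hef, ih, ht, lie_smul,
        Function.iterate_succ_apply', ← add_smul]
      congr 1
      push_cast
      ring
  induction n with
  | zero => exact hw
  | succ n ih =>
    intro h0
    have := he n
    rw [h0, lie_zero, eq_comm, smul_eq_zero] at this
    refine this.elim (mul_ne_zero ?_ hc) ih
    exact Nat.cast_ne_zero.mpr n.succ_ne_zero

namespace IsEALA

variable {k E : Type*} [Field k] [LieRing E] [LieAlgebra k E]
  {B : E →ₗ[k] E →ₗ[k] k} {H : LieSubalgebra k E}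

section Basic

variable (h : IsEALA B H)
include h

theorem mem_iff {x : E} : x ∈ H ↔ x ∈ wtSpace H 0 := by
  rw [h.self_centralizing]; rfl

theorem lie_eq_zero {x y : E} (hx : x ∈ H) (hy : y ∈ H) : ⁅x, y⁆ = 0 := by
  simpa using h.mem_iff.mp hy ⟨x, hx⟩

/-- The projection of `E` onto a weight space. -/
noncomputable def proj : Module.Dual k H → E →ₗ[k] E :=
  (exists_wtSpace_proj (fun x y => h.lie_eq_zero x.2 y.2) h.toral).choose

theorem proj_spec :
    (∀ α x, h.proj α x ∈ wtSpace H α) ∧ (∀ α, ∀ x ∈ wtSpace H α, h.proj α x = x) ∧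
      (∀ α β, α ≠ β → ∀ x ∈ wtSpace H α, h.proj β x = 0) ∧
      (∀ x, ∃ s : Finset (Module.Dual k H),
        (∀ α, α ∈ s ↔ h.proj α x ≠ 0) ∧ ∑ α ∈ s, h.proj α x = x) :=
  (exists_wtSpace_proj (fun x y => h.lie_eq_zero x.2 y.2) h.toral).choose_spec

theorem proj_mem (α : Module.Dual k H) (x : E) : h.proj α x ∈ wtSpace H α := h.proj_spec.1 α x

theorem proj_same {α : Module.Dual k H} {x : E} (hx : x ∈ wtSpace H α) : h.proj α x = x :=
  h.proj_spec.2.1 α x hx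

theorem proj_ne {α β : Module.Dual k H} (hαβ : α ≠ β) {x : E} (hx : x ∈ wtSpace H α) :
    h.proj β x = 0 := h.proj_spec.2.2.1 α β hαβ x hx

theorem exists_support (x : E) :
    ∃ s : Finset (Module.Dual k H), (∀ α, α ∈ s ↔ h.proj α x ≠ 0) ∧ ∑ α ∈ s, h.proj α x = x :=
  h.proj_spec.2.2.2 x

theorem eq_zero_of_proj {x : E} (hx : ∀ α, h.proj α x = 0) : x = 0 := by
  obtain ⟨s, -, hs⟩ := h.exists_support x
  rw [← hs]
  exact Finset.sum_eq_zero fun α _ => hx α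

theorem induction_wtSpace {p : E → Prop} (mem : ∀ α, ∀ x ∈ wtSpace H α, p x) (zero : p 0)
    (add : ∀ x y, p x → p y → p (x + y)) (x : E) : p x := by
  obtain ⟨s, -, hs⟩ := h.exists_support x
  rw [← hs]
  exact Finset.sum_induction _ p add zero fun α _ => mem α _ (h.proj_mem α x)

theorem proj_lie_right {β : Module.Dual k H} {y : E} (hy : y ∈ wtSpace H β) (x : E)
    (α : Module.Dual k H) : h.proj (α + β) ⁅x, y⁆ = ⁅h.proj α x, y⁆ := by
  induction x using h.induction_wtSpace with
  | mem γ x hx =>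
    by_cases hγ : γ = α
    · subst hγ
      rw [h.proj_same hx, h.proj_same (lie_mem_wtSpace hx hy)]
    · rw [h.proj_ne hγ hx, zero_lie, h.proj_ne _ (lie_mem_wtSpace hx hy)]
      simpa using hγ
  | zero => simp
  | add x₁ x₂ h₁ h₂ => simp [h₁, h₂]

theorem proj_lie_of_mem {t : E} (ht : t ∈ H) (x : E) (α : Module.Dual k H) :
    h.proj α ⁅t, x⁆ = ⁅t, h.proj α x⁆ := by
  have := h.proj_lie_right (h.mem_iff.mp ht) x α
  rw [add_zero] at this
  rw [← lie_skew, map_neg, this, lie_skew]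

theorem exists_rep : ∃ r : Module.Dual k H →ₗ[k] H,
    ∀ α (x : H), B (r α : E) (x : E) = α x := by
  have := h.H_fd
  let φ : H →ₗ[k] Module.Dual k H :=
    (LinearMap.lcomp k k H.toSubmodule.subtype) ∘ₗ B ∘ₗ H.toSubmodule.subtype
  have hφ : ∀ t x : H, φ t x = B (t : E) (x : E) := fun t x => rfl
  have hinj : Function.Injective φ := by
    rw [injective_iff_map_eq_zero]
    intro t ht
    exact h.H_nondeg t fun x => by rw [← hφ, ht]; rfl
  let ψ := LinearEquiv.ofInjectiveOfFinrankEq φ hinj Subspace.dual_finrank_eq.symm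
  refine ⟨ψ.symm.toLinearMap, fun α x => ?_⟩
  rw [← hφ]
  exact congrArg (fun (β : Module.Dual k H) => β x) (ψ.apply_symm_apply α)

/-- The element of `H` representing a linear form on `H`. -/
noncomputable def rep : Module.Dual k H →ₗ[k] H := h.exists_rep.choose

theorem rep_spec (α : Module.Dual k H) (x : H) : B (h.rep α : E) (x : E) = α x :=
  h.exists_rep.choose_spec α x

theorem eq_rep {α : Module.Dual k H} {t : H} (ht : t ∈ reps B H α) : t = h.rep α := by
  rw [← sub_eq_zero]
  refine h.H_nondeg _ fun x => ?_
  rw [AddSubgroupClass.coe_sub, map_sub, LinearMap.sub_apply, ht x, h.rep_spec, sub_self]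

theorem apply_rep_comm (α β : Module.Dual k H) : α (h.rep β) = β (h.rep α) := by
  rw [← h.rep_spec, ← h.rep_spec, h.symm]

theorem mem_anisoRootSet {α : Module.Dual k H} :
    α ∈ anisoRootSet B H ↔ α ∈ rootSet H ∧ α (h.rep α) ≠ 0 := by
  refine and_congr_right fun _ => ⟨?_, fun hα => ⟨h.rep α, h.rep_spec α, by rwa [h.rep_spec]⟩⟩
  rintro ⟨t, ht, ht'⟩
  rw [h.eq_rep ht, h.rep_spec] at ht'
  exact ht'

theorem form_eq_zero {α β : Module.Dual k H} (hαβ : α + β ≠ 0) {x y : E}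
    (hx : x ∈ wtSpace H α) (hy : y ∈ wtSpace H β) : B x y = 0 := by
  obtain ⟨t, ht⟩ : ∃ t, (α + β) t ≠ 0 := by
    by_contra! hcon
    exact hαβ (LinearMap.ext hcon)
  have h1 : B ⁅x, (t : E)⁆ y = B x ⁅(t : E), y⁆ := h.invariant _ _ _
  rw [← lie_skew, hx t, hy t, map_neg, LinearMap.neg_apply, map_smul, map_smul,
    LinearMap.smul_apply, smul_eq_mul, smul_eq_mul] at h1
  have h2 : (α + β) t * B x y = 0 := by
    rw [LinearMap.add_apply]
    linear_combination -h1
  exact (mul_eq_zero.mp h2).resolve_left ht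

theorem lie_eq_smul_rep {α : Module.Dual k H} {x y : E}
    (hx : x ∈ wtSpace H α) (hy : y ∈ wtSpace H (-α)) : ⁅x, y⁆ = B x y • (h.rep α : E) := by
  have hmem : ⁅x, y⁆ ∈ H := h.mem_iff.mpr (by simpa using lie_mem_wtSpace hx hy)
  have := h.H_nondeg (⟨_, hmem⟩ - B x y • h.rep α) fun t => by
    have hxt : B ⁅x, y⁆ (t : E) = α t * B x y := by
      rw [h.invariant, ← lie_skew, hy t, map_neg, map_smul, LinearMap.neg_apply]
      simp
    have hrt := h.rep_spec α t
    simp only [AddSubgroupClass.coe_sub, SetLike.val_smul, map_sub, map_smul,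
      LinearMap.sub_apply, LinearMap.smul_apply, smul_eq_mul, hxt, hrt]
    ring
  simpa [sub_eq_zero, Subtype.ext_iff] using this

theorem exists_form_eq_one {α : Module.Dual k H} {x : E} (hx : x ∈ wtSpace H α) (hx0 : x ≠ 0) :
    ∃ y ∈ wtSpace H (-α), B x y = 1 := by
  obtain ⟨y, hy⟩ : ∃ y, B x y ≠ 0 := by
    by_contra! hcon
    exact hx0 (h.nondeg x hcon)
  obtain ⟨s, -, hs⟩ := h.exists_support y
  rw [← hs, map_sum] at hy
  obtain ⟨β, -, hβ⟩ := Finset.exists_ne_zero_of_sum_ne_zero hy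
  have hβα : β = -α := by
    by_contra hne
    exact hβ (h.form_eq_zero (fun h0 => hne (eq_neg_of_add_eq_zero_right h0)) hx
      (h.proj_mem β y))
  subst hβα
  refine ⟨(B x (h.proj (-α) y))⁻¹ • h.proj (-α) y, Submodule.smul_mem _ _ (h.proj_mem _ y), ?_⟩
  rw [map_smul, smul_eq_mul, inv_mul_cancel₀ hβ]

omit h in
theorem mem_rootSet {α : Module.Dual k H} :
    α ∈ rootSet H ↔ ∃ x ∈ wtSpace H α, x ≠ 0 :=
  Submodule.ne_bot_iff _

theorem neg_mem_rootSet {α : Module.Dual k H} (hα : α ∈ rootSet H) : -α ∈ rootSet H := by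
  obtain ⟨x, hx, hx0⟩ := mem_rootSet.mp hα
  obtain ⟨y, hy, hxy⟩ := h.exists_form_eq_one hx hx0
  refine mem_rootSet.mpr ⟨y, hy, ?_⟩
  rintro rfl
  simp at hxy

theorem neg_mem_anisoRootSet {α : Module.Dual k H} (hα : α ∈ anisoRootSet B H) :
    -α ∈ anisoRootSet B H := by
  rw [h.mem_anisoRootSet] at hα ⊢
  exact ⟨h.neg_mem_rootSet hα.1, by simpa using hα.2⟩

/-- The coroot of an anisotropic root. -/
noncomputable def coroot (α : Module.Dual k H) : H := (2 / α (h.rep α)) • h.rep α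

theorem apply_coroot (α β : Module.Dual k H) :
    β (h.coroot α) = 2 / α (h.rep α) * β (h.rep α) := by
  rw [coroot, map_smul, smul_eq_mul]

theorem apply_coroot_self {α : Module.Dual k H} (hα : α ∈ anisoRootSet B H) :
    α (h.coroot α) = 2 := by
  rw [apply_coroot, div_mul_cancel₀ _ (h.mem_anisoRootSet.mp hα).2]

section CharZero

variable [CharZero k]

theorem exists_isSl2Triple {α : Module.Dual k H} (hα : α ∈ anisoRootSet B H) {x : E}
    (hx : x ∈ wtSpace H α) (hx0 : x ≠ 0) :
    ∃ y ∈ wtSpace H (-α), IsSl2Triple (h.coroot α : E) x y := by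
  obtain ⟨y, hy, hxy⟩ := h.exists_form_eq_one hx hx0
  have hy' : (2 / α (h.rep α)) • y ∈ wtSpace H (-α) := Submodule.smul_mem _ _ hy
  refine ⟨_, hy', ?_, ?_, ?_, ?_⟩
  · intro h0
    have := h.apply_coroot_self hα
    rw [ZeroMemClass.coe_eq_zero.mp h0, map_zero] at this
    exact two_ne_zero this.symm
  · rw [lie_smul, h.lie_eq_smul_rep hx hy, hxy, one_smul]
    rfl
  · rw [hx, h.apply_coroot_self hα, two_smul, two_smul]
  · rw [hy', LinearMap.neg_apply, h.apply_coroot_self hα, two_smul, neg_smul, two_smul]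

theorem exists_int_apply_coroot {α β : Module.Dual k H} (hα : α ∈ anisoRootSet B H)
    (hβ : β ∈ rootSet H) : ∃ m : ℤ, β (h.coroot α) = m := by
  obtain ⟨x, hx, hx0⟩ := mem_rootSet.mp (h.mem_anisoRootSet.mp hα).1
  obtain ⟨y, hy, ht⟩ := h.exists_isSl2Triple hα hx hx0
  obtain ⟨v, hv, hv0⟩ := mem_rootSet.mp hβ
  obtain ⟨n, hn₁, hn₂⟩ := Nat.exists_not_and_succ_of_not_zero_of_exists
    (p := fun N => (fun w => ⁅x, w⁆)^[N] v = 0) hv0 (h.ea2 α hα x hx v)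
  rw [Function.iterate_succ_apply'] at hn₂
  have hw := iterate_lie_mem_wtSpace hx hv n
  have P : ht.HasPrimitiveVectorWith ((fun w => ⁅x, w⁆)^[n] v) (β (h.coroot α) + 2 * n) :=
    ⟨hn₁, by rw [hw, LinearMap.add_apply, LinearMap.smul_apply, h.apply_coroot_self hα,
      nsmul_eq_mul, mul_comm], hn₂⟩
  obtain ⟨m, hm⟩ := P.exists_nat_of_iterate_eq_zero
    (h.ea2 _ (h.neg_mem_anisoRootSet hα) y hy _)
  refine ⟨m - 2 * n, ?_⟩
  push_cast
  rw [← hm]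
  ring

/-- Root strings in a non-isotropic direction cannot be infinite along an isotropic root. -/
theorem apply_rep_eq_zero_of_forall_add_nsmul_mem {α β : Module.Dual k H} (hβ : β ∈ rootSet H)
    (hβ0 : β (h.rep β) = 0) (hstr : ∀ n : ℕ, α + n • β ∈ rootSet H) : α (h.rep β) = 0 := by
  by_contra hc
  set c := α (h.rep β) with hcdef
  set g := α (h.rep α) with hgdef
  have hβα : β (h.rep α) = c := h.apply_rep_comm _ _
  have hg : ∀ n : ℕ, (α + n • β) (h.rep (α + n • β)) = g + 2 * n * c := by
    intro n
    simp only [map_add, map_nsmul, LinearMap.add_apply, LinearMap.smul_apply, hβ0, hβα,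
      ← hcdef, ← hgdef, nsmul_eq_mul]
    ring
  have hmul : ∀ n : ℕ, g + 2 * n * c ≠ 0 → ∃ m : ℤ, 2 * c = m * (g + 2 * n * c) := by
    intro n hn
    have hmem : α + n • β ∈ anisoRootSet B H :=
      h.mem_anisoRootSet.mpr ⟨hstr n, by rwa [hg]⟩
    obtain ⟨m, hm⟩ := h.exists_int_apply_coroot hmem hβ
    refine ⟨m, ?_⟩
    rw [h.apply_coroot, hg] at hm
    have : β (h.rep (α + n • β)) = c := by
      simp [map_add, map_nsmul, hβ0, hβα]
    rw [this] at hm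
    field_simp at hm
    linear_combination hm
  have key : ∀ n d : ℕ, 3 ≤ d → g + 2 * n * c ≠ 0 → g + 2 * (n + d : ℕ) * c ≠ 0 → False := by
    intro n d hd h1 h2
    obtain ⟨m₁, hm₁⟩ := hmul n h1
    obtain ⟨m₂, hm₂⟩ := hmul (n + d) h2
    have h3 : (2 * c) * ((m₁ : k) - m₂ - d * m₁ * m₂) = 0 := by
      push_cast at hm₂ h2
      linear_combination (m₁ : k) * hm₂ - (m₂ : k) * hm₁
    have h4 := (mul_eq_zero.mp h3).resolve_left (mul_ne_zero two_ne_zero hc)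
    have h5 : m₁ - m₂ - d * m₁ * m₂ = 0 := by exact_mod_cast h4
    have hm₁0 : m₁ ≠ 0 := by
      rintro rfl
      simp [hc] at hm₁
    have h12 : m₁ ∣ m₂ := ⟨1 - d * m₂, by linear_combination -h5⟩
    have h21 : m₂ ∣ m₁ := ⟨1 + d * m₁, by linear_combination h5⟩
    have hd' : (3 : ℤ) ≤ d := by exact_mod_cast hd
    rcases Int.natAbs_eq_natAbs_iff.mp (Int.natAbs_eq_of_dvd_dvd h12 h21) with h6 | h6
    · have : (d : ℤ) * (m₁ * m₁) = 0 := by rw [← h6] at h5; linear_combination -h5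
      have := mul_self_pos.mpr hm₁0
      nlinarith
    · have h7 : m₁ * (2 + d * m₁) = 0 := by
        have : m₂ = -m₁ := by omega
        rw [this] at h5
        linear_combination h5
      have h8 := (mul_eq_zero.mp h7).resolve_left hm₁0
      have h9 : m₁ < 0 := by nlinarith
      nlinarith
  by_cases h0 : g + 2 * (0 : ℕ) * c = 0
  · have hg0 : g = 0 := by simpa using h0
    refine key 1 3 le_rfl ?_ ?_ <;> rw [hg0] <;> push_cast <;>
      simp [hc]
  · by_cases h3 : g + 2 * (3 : ℕ) * c = 0
    · refine key 0 6 (by norm_num) h0 ?_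
      push_cast at h3 ⊢
      intro h6
      have : (6 : k) * c = 0 := by linear_combination h6 - h3
      simp [hc] at this
    · exact key 0 3 le_rfl h0 h3

/-- Isotropic roots are orthogonal to all roots. -/
theorem apply_rep_eq_zero_of_isotropic {α β : Module.Dual k H} (hα : α ∈ rootSet H)
    (hβ : β ∈ rootSet H) (hβ0 : β (h.rep β) = 0) : α (h.rep β) = 0 := by
  by_contra hc
  obtain ⟨v, hv, hv0⟩ := mem_rootSet.mp hα
  obtain ⟨e, he, he0⟩ := mem_rootSet.mp hβ
  obtain ⟨f, hf, hef⟩ := h.exists_form_eq_one he he0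
  have hef' : ⁅e, f⁆ = (h.rep β : E) := by rw [h.lie_eq_smul_rep he hf, hef, one_smul]
  by_cases hnil : ∃ N : ℕ, (fun w => ⁅e, w⁆)^[N] v = 0
  · obtain ⟨N, hN₁, hN₂⟩ := Nat.exists_not_and_succ_of_not_zero_of_exists
      (p := fun N => (fun w => ⁅e, w⁆)^[N] v = 0) hv0 hnil
    rw [Function.iterate_succ_apply'] at hN₂
    have hw := iterate_lie_mem_wtSpace he hv N
    have hγ : (α + N • β) (h.rep β) = α (h.rep β) := by simp [hβ0]
    have hstr : ∀ n : ℕ, (α + N • β) + n • (-β) ∈ rootSet H := fun n =>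
      mem_rootSet.mpr ⟨_, iterate_lie_mem_wtSpace hf hw n,
        iterate_lie_ne_zero_of_heisenberg hef' (by rw [hf]; simp [hβ0]) hc
          (by rw [hw, hγ]) hN₂ hN₁ n⟩
    have := h.apply_rep_eq_zero_of_forall_add_nsmul_mem (h.neg_mem_rootSet hβ)
      (by simpa using hβ0) hstr
    rw [map_neg, map_neg, hγ, neg_eq_zero] at this
    exact hc this
  · push Not at hnil
    exact hc (h.apply_rep_eq_zero_of_forall_add_nsmul_mem hβ hβ0 fun n =>
      mem_rootSet.mpr ⟨_, iterate_lie_mem_wtSpace he hv n, hnil n⟩)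

theorem lie_ne_zero {α β : Module.Dual k H} (hα : α ∈ anisoRootSet B H) {x y : E}
    (hx : x ∈ wtSpace H α) (hx0 : x ≠ 0) (hy : y ∈ wtSpace H β) (hy0 : y ≠ 0)
    (hβ : β (h.coroot α) = -2) : ⁅x, y⁆ ≠ 0 := by
  intro hxy
  obtain ⟨f, hf, ht⟩ := h.exists_isSl2Triple hα hx hx0
  have P : ht.HasPrimitiveVectorWith y (-2 : k) := ⟨hy0, by rw [hy, hβ], hxy⟩
  obtain ⟨n, hn⟩ := P.exists_nat_of_iterate_eq_zero (h.ea2 _ (h.neg_mem_anisoRootSet hα) f hf _)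
  have h2 : ((n + 2 : ℕ) : k) = 0 := by
    push_cast
    rw [← hn]
    ring
  exact absurd h2 (Nat.cast_ne_zero.mpr (by omega))

omit h [CharZero k] in
theorem mem_core {α : Module.Dual k H} (hα : α ∈ anisoRootSet B H) {x : E}
    (hx : x ∈ wtSpace H α) : x ∈ core B H :=
  LieSubalgebra.subset_lieSpan (Set.mem_biUnion hα hx)

omit h [CharZero k] in
theorem core_induction {p : (x : E) → x ∈ core B H → Prop}
    (mem : ∀ α (hα : α ∈ anisoRootSet B H) x (hx : x ∈ wtSpace H α), p x (mem_core hα hx))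
    (zero : p 0 (zero_mem _)) (add : ∀ x y hx hy, p x hx → p y hy → p (x + y) (add_mem hx hy))
    (smul : ∀ (c : k) x hx, p x hx → p (c • x) ((core B H).smul_mem c hx))
    (lie : ∀ x y hx hy, p x hx → p y hy → p ⁅x, y⁆ ((core B H).lie_mem hx hy)) {x : E}
    (hx : x ∈ core B H) : p x hx := by
  refine LieSubalgebra.lieSpan_induction k (p := p) (fun x hx => ?_) zero add smul lie hx
  have hx' := hx
  simp only [Set.mem_iUnion] at hx'
  obtain ⟨α, hα, hxα⟩ := hx'
  exact mem α hα x hxα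

omit h [CharZero k] in
/-- An element centralizes the core as soon as it centralizes the anisotropic root spaces. -/
theorem lie_core_eq_zero {z : E}
    (hz : ∀ α ∈ anisoRootSet B H, ∀ x ∈ wtSpace H α, ⁅z, x⁆ = 0) :
    ∀ w ∈ core B H, ⁅z, w⁆ = 0 := by
  intro w hw
  induction hw using core_induction with
  | mem α hα x hx => exact hz α hα x hx
  | zero => simp
  | add x y _ _ hx hy => simp [hx, hy]
  | smul c x _ hx => simp [hx]
  | lie x y _ _ hx hy => simp [leibniz_lie z, hx, hy]

theorem lie_mem_core (e : E) {x : E} (hx : x ∈ core B H) : ⁅e, x⁆ ∈ core B H := by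
  induction e using h.induction_wtSpace with
  | mem β e he =>
    induction hx using core_induction with
    | mem α hα x hx =>
      by_cases he0 : e = 0
      · simp [he0]
      have hβ : β ∈ rootSet H := mem_rootSet.mpr ⟨e, he, he0⟩
      by_cases hββ : β (h.rep β) = 0
      · by_cases hex : ⁅e, x⁆ = 0
        · rw [hex]; exact zero_mem _
        · have hαβ := h.apply_rep_eq_zero_of_isotropic (h.mem_anisoRootSet.mp hα).1 hβ hββ
          have hβα : β (h.rep α) = 0 := by rw [h.apply_rep_comm, hαβ]
          refine mem_core (α := β + α) (h.mem_anisoRootSet.mpr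
            ⟨mem_rootSet.mpr ⟨_, lie_mem_wtSpace he hx, hex⟩, ?_⟩) (lie_mem_wtSpace he hx)
          simpa [hββ, hαβ, hβα] using (h.mem_anisoRootSet.mp hα).2
      · exact LieSubalgebra.lie_mem _ (mem_core (h.mem_anisoRootSet.mpr ⟨hβ, hββ⟩) he)
          (mem_core hα hx)
    | zero => simp
    | add x y _ _ hx hy => rw [lie_add]; exact add_mem hx hy
    | smul c x _ hx => rw [lie_smul]; exact (core B H).smul_mem c hx
    | lie x y hxc hyc hx hy =>
      rw [leibniz_lie]
      exact add_mem ((core B H).lie_mem hx hyc) ((core B H).lie_mem hxc hy)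
  | zero => simp
  | add e₁ e₂ h₁ h₂ => rw [add_lie]; exact add_mem h₁ h₂

theorem coroot_mem_core {α : Module.Dual k H} (hα : α ∈ anisoRootSet B H) :
    (h.coroot α : E) ∈ core B H := by
  obtain ⟨x, hx, hx0⟩ := mem_rootSet.mp (h.mem_anisoRootSet.mp hα).1
  obtain ⟨y, hy, ht⟩ := h.exists_isSl2Triple hα hx hx0
  rw [← ht.lie_e_f]
  exact (core B H).lie_mem (mem_core hα hx) (mem_core (h.neg_mem_anisoRootSet hα) hy)

theorem apply_eq_zero_of_isotropic {β : Module.Dual k H} (hβ : β ∈ rootSet H)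
    (hβ0 : β (h.rep β) = 0) {t : H} (ht : (t : E) ∈ core B H) : β t = 0 := by
  have hcent : ∀ w ∈ core B H, ⁅(h.rep β : E), w⁆ = 0 := lie_core_eq_zero fun α hα x hx => by
    rw [hx, h.apply_rep_eq_zero_of_isotropic (h.mem_anisoRootSet.mp hα).1 hβ hβ0, zero_smul]
  have hB : ∀ x ∈ core B H, B (h.rep β : E) x = 0 := by
    intro x hx
    induction hx using core_induction with
    | mem α hα x hx =>
      refine h.form_eq_zero (α := 0) ?_ (h.mem_iff.mp (h.rep β).2) hx
      rw [zero_add]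
      rintro rfl
      simpa using (h.mem_anisoRootSet.mp hα).2
    | zero => simp
    | add x y _ _ hx hy => simp [hx, hy]
    | smul c x _ hx => simp [hx]
    | lie x y hxc _ _ _ => rw [← h.invariant, hcent x hxc, map_zero, LinearMap.zero_apply]
  rw [← h.rep_spec]
  exact hB _ ht

section Central

variable {z : E} (hz : ∀ w ∈ core B H, ⁅z, w⁆ = 0)
include hz

theorem lie_central (e : E) : ∀ w ∈ core B H, ⁅⁅z, e⁆, w⁆ = 0 := by
  intro w hw
  rw [lie_lie, hz w hw, hz _ (h.lie_mem_core e hw), lie_zero, sub_zero]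

theorem lie_mem_core_of_central (e : E) : ⁅z, e⁆ ∈ core B H :=
  h.ea4 _ (h.lie_central hz e)

theorem lie_lie_eq_zero_of_central (e : E) : ⁅z, ⁅z, e⁆⁆ = 0 :=
  hz _ (h.lie_mem_core_of_central hz e)

omit [CharZero k] in
theorem proj_central (β : Module.Dual k H) : ∀ w ∈ core B H, ⁅h.proj β z, w⁆ = 0 :=
  lie_core_eq_zero fun α hα x hx => by
    rw [← h.proj_lie_right hx, hz x (mem_core hα hx), map_zero]

end Central

omit [CharZero k] in
theorem lie_eq_zero_of_lie_lie_eq_zero {y e : E} (hy : y ∈ H) (hye : ⁅y, ⁅y, e⁆⁆ = 0) :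
    ⁅y, e⁆ = 0 := by
  refine h.eq_zero_of_proj fun α => ?_
  have hα : ∀ x, ⁅y, h.proj α x⁆ = α ⟨y, hy⟩ • h.proj α x := fun x => h.proj_mem α x ⟨y, hy⟩
  have h2 : h.proj α ⁅y, ⁅y, e⁆⁆ = 0 := by rw [hye, map_zero]
  rw [h.proj_lie_of_mem hy, hα, h.proj_lie_of_mem hy, hα, smul_smul] at h2
  rw [h.proj_lie_of_mem hy, hα]
  rcases smul_eq_zero.mp h2 with h3 | h3
  · rw [mul_self_eq_zero.mp h3, zero_smul]
  · rw [h3, smul_zero]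

end CharZero

end Basic

section TwoStructures

variable [CharZero k] {B' : E →ₗ[k] E →ₗ[k] k} {H' : LieSubalgebra k E}
  (h : IsEALA B H) (h' : IsEALA B' H')
include h'
include h

/-- Elements of the two Cartan subalgebras of the core that agree modulo the centre of the core
differ by an element of the centre of `E`. -/
theorem mem_of_sub_central {x y : E} (hx : x ∈ H) (hxc : x ∈ core B H) (hy : y ∈ H')
    (hz : ∀ w ∈ core B H, ⁅x - y, w⁆ = 0) : x ∈ H' := by
  have hyc : y ∈ core B H := by
    simpa using sub_mem hxc (h.ea4 _ hz)
  have hzE : ∀ e : E, ⁅x - y, e⁆ = 0 := by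
    intro e
    induction e using h.induction_wtSpace with
    | mem α e he =>
      set z := x - y with hzdef
      have hxe : ⁅x, e⁆ = α ⟨x, hx⟩ • e := he ⟨x, hx⟩
      have hyw : ⁅y, ⁅z, e⁆⁆ = 0 := by
        rw [← lie_skew, h.lie_central hz e y hyc, neg_zero]
      have hxw : ⁅x, ⁅z, e⁆⁆ = 0 := by
        rw [← lie_skew, h.lie_central hz e x hxc, neg_zero]
      by_cases hα : α ⟨x, hx⟩ = 0
      · have hye : ⁅y, e⁆ = -⁅z, e⁆ := by
          rw [hzdef, sub_lie, hxe, hα, zero_smul, zero_sub, neg_neg]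
        have := h'.lie_eq_zero_of_lie_lie_eq_zero hy (e := e) (by rw [hye, lie_neg, hyw, neg_zero])
        rwa [hye, neg_eq_zero] at this
      · have hxz : ⁅x, z⁆ = 0 := by rw [← lie_skew, hz x hxc, neg_zero]
        rw [leibniz_lie, hxz, zero_lie, zero_add, hxe, lie_smul, smul_eq_zero] at hxw
        exact hxw.resolve_left hα
    | zero => simp
    | add e₁ e₂ h₁ h₂ => rw [lie_add, h₁, h₂, add_zero]
  have hz' : x - y ∈ H' := h'.mem_iff.mpr fun t => by
    rw [← lie_skew, hzE, neg_zero, LinearMap.zero_apply, zero_smul]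
  simpa using add_mem hz' hy

variable (hcores : core B H = core B' H') (hHc : ∀ t ∈ core B H, t ∈ H ↔ t ∈ H')
include hcores hHc

/-- Anisotropic root vectors for one structure are weight vectors for the other. -/
theorem exists_mem_wtSpace {α' : Module.Dual k H'} (hα' : α' ∈ anisoRootSet B' H') {x : E}
    (hx : x ∈ wtSpace H' α') : ∃ α : Module.Dual k H, x ∈ wtSpace H α := by
  classical
  by_cases hx0 : x = 0
  · exact ⟨0, hx0 ▸ zero_mem _⟩
  obtain ⟨y, hy, ht⟩ := h'.exists_isSl2Triple hα' hx hx0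
  have hcomp : ∀ (γ : Module.Dual k H') (v : E), v ∈ wtSpace H' γ → ∀ a : Module.Dual k H,
      h.proj a v ≠ 0 → ∀ (t : E) (htH : t ∈ H) (htH' : t ∈ H'), a ⟨t, htH⟩ = γ ⟨t, htH'⟩ := by
    intro γ v hv a ha t htH htH'
    have h1 := h.proj_lie_of_mem htH v a
    rw [show ⁅t, v⁆ = γ ⟨t, htH'⟩ • v from hv ⟨t, htH'⟩, map_smul,
      show ⁅t, h.proj a v⁆ = a ⟨t, htH⟩ • h.proj a v from h.proj_mem a v ⟨t, htH⟩] at h1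
    exact (smul_left_injective k ha h1).symm
  have hsc : (h'.coroot α' : E) ∈ core B H := hcores ▸ h'.coroot_mem_core hα'
  have hsH : (h'.coroot α' : E) ∈ H := (hHc _ hsc).mpr (h'.coroot α').2
  obtain ⟨S, hS, hSsum⟩ := h.exists_support x
  obtain ⟨T, hT, hTsum⟩ := h.exists_support y
  have hSne : S.Nonempty := by
    rw [Finset.nonempty_iff_ne_empty]
    rintro rfl
    exact hx0 (by simpa using hSsum.symm)
  have hTne : T.Nonempty := by
    rw [Finset.nonempty_iff_ne_empty]
    rintro rfl
    exact ht.f_ne_zero (by simpa using hTsum.symm)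
  have hne : ∀ a ∈ S, ∀ b ∈ T, ⁅h.proj a x, h.proj b y⁆ ≠ 0 := by
    intro a ha b hb
    have ha0 := (hS a).mp ha
    have hb0 := (hT b).mp hb
    have hroot : a ∈ rootSet H := mem_rootSet.mpr ⟨_, h.proj_mem a x, ha0⟩
    have han : a ∈ anisoRootSet B H := by
      refine h.mem_anisoRootSet.mpr ⟨hroot, fun hiso => ?_⟩
      have h1 := h.apply_eq_zero_of_isotropic hroot hiso (t := ⟨_, hsH⟩) hsc
      rw [hcomp α' x hx a ha0 _ hsH (h'.coroot α').2] at h1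
      exact two_ne_zero ((h'.apply_coroot_self hα').symm.trans h1)
    have hcH' : (h.coroot a : E) ∈ H' := (hHc _ (h.coroot_mem_core han)).mp (h.coroot a).2
    refine h.lie_ne_zero han (h.proj_mem a x) ha0 (h.proj_mem b y) hb0 ?_
    have h1 := hcomp α' x hx a ha0 _ (h.coroot a).2 hcH'
    have h2 := hcomp (-α') y hy b hb0 _ (h.coroot a).2 hcH'
    have h3 : a (h.coroot a) = 2 := h.apply_coroot_self han
    rw [LinearMap.neg_apply, ← h1] at h2
    exact h2.trans (congrArg Neg.neg h3)
  have hsum : ∀ a ∈ S, ∀ b ∈ T, UniqueAdd S T a b → a + b = 0 := by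
    intro a ha b hb hu
    by_contra hab
    refine hne a ha b hb ?_
    have h1 : h.proj (a + b) ⁅x, y⁆ = 0 := by
      rw [ht.lie_e_f]
      exact h.proj_ne (Ne.symm hab) (h.mem_iff.mp hsH)
    have h2 : ⁅x, y⁆ = ∑ b' ∈ T, ⁅x, h.proj b' y⁆ := by
      rw [← lie_sum, hTsum]
    rw [h2, map_sum, Finset.sum_eq_single b] at h1
    · rwa [h.proj_lie_right (h.proj_mem b y)] at h1
    · intro b' hb' hbb'
      rw [show a + b = (a + b - b') + b' by abel, h.proj_lie_right (h.proj_mem b' y)]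
      by_cases hmem : a + b - b' ∈ S
      · exact absurd (hu hmem hb' (by abel)).2 hbb'
      · rw [not_not.mp ((hS _).not.mp hmem), zero_lie]
    · exact fun hb' => absurd hb hb'
  have hcard : S.card * T.card ≤ 1 := by
    by_contra! hlt
    let _ : Module ℚ (Module.Dual k H) := Module.compHom _ (algebraMap ℚ k)
    obtain ⟨p, hp, q, hq, hpq, hup, huq⟩ := TwoUniqueSums.uniqueAdd_of_one_lt_card hlt
    rw [Finset.mem_product] at hp hq
    have h0 := (hsum _ hp.1 _ hp.2 hup).trans (hsum _ hq.1 _ hq.2 huq).symm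
    exact hpq (Prod.ext (huq hp.1 hp.2 h0).1 (huq hp.1 hp.2 h0).2)
  have hS1 : S.card = 1 := by
    have h1 := hSne.card_pos
    have h2 := hTne.card_pos
    nlinarith
  obtain ⟨a, rfl⟩ := Finset.card_eq_one.mp hS1
  rw [Finset.sum_singleton] at hSsum
  exact ⟨a, hSsum ▸ h.proj_mem a x⟩

theorem proj_central_of_mem {t : E} (ht : t ∈ H') {β : Module.Dual k H} (hβ : β ≠ 0) :
    ∀ w ∈ core B H, ⁅h.proj β t, w⁆ = 0 := by
  rw [hcores]
  refine lie_core_eq_zero fun α' hα' x hx => ?_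
  obtain ⟨α, hxα⟩ := h.exists_mem_wtSpace h' hcores hHc hα' hx
  rw [← h.proj_lie_right hxα, show ⁅t, x⁆ = α' ⟨t, ht⟩ • x from hx ⟨t, ht⟩, map_smul,
    h.proj_ne (by simpa using hβ) hxα, smul_zero]

theorem sub_proj_zero_central {t : E} (ht : t ∈ H') :
    ∀ w ∈ core B H, ⁅t - h.proj 0 t, w⁆ = 0 := by
  classical
  intro w hw
  obtain ⟨s, hs, hsum⟩ := h.exists_support t
  rw [sub_lie, sub_eq_zero]
  conv_lhs => rw [← hsum]
  rw [sum_lie, Finset.sum_eq_single 0]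
  · exact fun β _ hβ => h.proj_central_of_mem h' hcores hHc ht hβ w hw
  · intro h0
    rw [not_not.mp ((hs _).not.mp h0), zero_lie]

/-- The Cartan subalgebra `H'` is the graph of a linear map from `H` to the part of the centre of
the core of nonzero weight. -/
theorem exists_linearMap_central : ∃ ζ : E →ₗ[k] E, ∀ s ∈ H,
    (∀ w ∈ core B H, ⁅ζ s, w⁆ = 0) ∧ h.proj 0 (ζ s) = 0 ∧ s + ζ s ∈ H' := by
  have hHc' : ∀ t ∈ core B' H', t ∈ H' ↔ t ∈ H := fun t ht => (hHc t (hcores ▸ ht)).symm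
  refine ⟨(LinearMap.id - h.proj 0) ∘ₗ (h'.proj 0 - LinearMap.id), fun s hs => ?_⟩
  set z := h'.proj 0 s - s with hzdef
  have hz : ∀ w ∈ core B H, ⁅z, w⁆ = 0 := by
    intro w hw
    have := h'.sub_proj_zero_central h hcores.symm hHc' hs w (hcores ▸ hw)
    rw [hzdef, ← neg_sub, neg_lie, this, neg_zero]
  have hval : ((LinearMap.id - h.proj 0) ∘ₗ (h'.proj 0 - LinearMap.id)) s = z - h.proj 0 z := rfl
  rw [hval]
  refine ⟨fun w hw => by rw [sub_lie, hz w hw, h.proj_central hz 0 w hw, sub_zero], ?_, ?_⟩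
  · rw [map_sub, h.proj_same (h.proj_mem 0 z), sub_self]
  · have h1 : h'.proj 0 s ∈ H' := h'.mem_iff.mpr (h'.proj_mem 0 s)
    have h2 : h.proj 0 z ∈ H' := (hHc _ (h.ea4 _ (h.proj_central hz 0))).mp
      (h.mem_iff.mpr (h.proj_mem 0 z))
    have := sub_mem h1 h2
    rwa [show h'.proj 0 s - h.proj 0 z = s + (z - h.proj 0 z) by rw [hzdef]; abel] at this

end TwoStructures

/-- A linear map from `H` to the nonzero-weight part of the centre of the core satisfying the
cocycle condition is a coboundary. -/
theorem exists_central_lie_eq [CharZero k] (h : IsEALA B H) (ζ : E →ₗ[k] E)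
    (hζ : ∀ s ∈ H, ∀ w ∈ core B H, ⁅ζ s, w⁆ = 0) (hζ0 : ∀ s ∈ H, h.proj 0 (ζ s) = 0)
    (hcoc : ∀ s ∈ H, ∀ t ∈ H, ⁅s, ζ t⁆ = ⁅t, ζ s⁆) :
    ∃ z, (∀ w ∈ core B H, ⁅z, w⁆ = 0) ∧ ∀ s ∈ H, ⁅s, z⁆ = ζ s := by
  classical
  have hcomp : ∀ β : Module.Dual k H, ∃ z ∈ wtSpace H β, (∀ w ∈ core B H, ⁅z, w⁆ = 0) ∧
      ∀ s : H, h.proj β (ζ s) = β s • z := by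
    intro β
    by_cases hβ : β = 0
    · subst hβ
      exact ⟨0, zero_mem _, by simp, fun s => by rw [hζ0 s s.2, smul_zero]⟩
    obtain ⟨t, ht⟩ : ∃ t, β t ≠ 0 := by
      by_contra! hcon
      exact hβ (LinearMap.ext hcon)
    refine ⟨(β t)⁻¹ • h.proj β (ζ t), Submodule.smul_mem _ _ (h.proj_mem _ _), fun w hw => ?_,
      fun s => ?_⟩
    · rw [smul_lie, h.proj_central (hζ t t.2) β w hw, smul_zero]
    · have h1 := congrArg (h.proj β) (hcoc s s.2 t t.2)
      rw [h.proj_lie_of_mem s.2, h.proj_lie_of_mem t.2, h.proj_mem β _ s, h.proj_mem β _ t] at h1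
      rw [smul_comm, h1, inv_smul_smul₀ ht]
  choose Z hZwt hZc hZ using hcomp
  have := h.H_fd
  let b := Module.finBasis k H
  choose S hS hSsum using fun i => h.exists_support (ζ (b i))
  let U := Finset.univ.biUnion S
  refine ⟨∑ β ∈ U, Z β, fun w hw => ?_, fun s hs => ?_⟩
  · rw [sum_lie]
    exact Finset.sum_eq_zero fun β _ => hZc β w hw
  · have hlin : (∑ β ∈ U, h.proj β) ∘ₗ ζ ∘ₗ H.toSubmodule.subtype
        = ζ ∘ₗ H.toSubmodule.subtype := by
      refine b.ext fun i => ?_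
      change (∑ β ∈ U, h.proj β) (ζ (b i)) = ζ (b i)
      rw [LinearMap.sum_apply]
      conv_rhs => rw [← hSsum i]
      symm
      refine Finset.sum_subset (Finset.subset_biUnion_of_mem S (Finset.mem_univ i))
        fun β _ hβ => not_not.mp ((hS i β).not.mp hβ)
    have h1 : (∑ β ∈ U, h.proj β) (ζ s) = ζ s := LinearMap.congr_fun hlin ⟨s, hs⟩
    rw [← h1, LinearMap.sum_apply, lie_sum]
    refine Finset.sum_congr rfl fun β _ => ?_
    rw [hZ β ⟨s, hs⟩]
    exact hZwt β ⟨s, hs⟩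

end IsEALA

theorem exists_lieEquiv_sub_lie {k E : Type*} [Field k] [LieRing E] [LieAlgebra k E] (z : E)
    (hz : ∀ e : E, ⁅z, ⁅z, e⁆⁆ = 0) (hz' : ∀ x y : E, ⁅⁅z, x⁆, ⁅z, y⁆⁆ = 0) :
    ∃ f : E ≃ₗ⁅k⁆ E, ∀ e, f e = e - ⁅z, e⁆ :=
  ⟨{ toFun := fun e => e - ⁅z, e⁆
     invFun := fun e => e + ⁅z, e⁆
     map_add' := fun x y => by rw [lie_add]; abel
     map_smul' := fun c x => by rw [lie_smul, smul_sub, RingHom.id_apply]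
     map_lie' := fun {x y} => by
       rw [lie_sub, sub_lie, sub_lie, hz', leibniz_lie z x y]
       abel
     left_inv := fun e => by simp [hz]
     right_inv := fun e => by simp [hz] }, fun _ => rfl⟩

/-- Theorem 7.1 of the paper: let `(E,H,(·|·))` and `(E,H',(·|·)')` be two
EALA structures on the same Lie algebra `E` with common core `E_c` (Corollary 3.2),
and put `H_c = H ∩ E_c`, `H'_c = H' ∩ E_c`.  If the images `H_cc`, `H'_cc` of `H_c`,
`H'_c` in `E_c/Z(E_c)` coincide, then `H_c = H'_c`, and `H` and `H'` are conjugate under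
an automorphism of `E` fixing `E_c` pointwise. -/
theorem eala_conjugacy_from_equal_centreless_cartans
    {k E : Type*} [Field k] [CharZero k] [IsAlgClosed k] [LieRing E] [LieAlgebra k E]
    (B : E →ₗ[k] E →ₗ[k] k) (H : LieSubalgebra k E) (h : IsEALA B H)
    (B' : E →ₗ[k] E →ₗ[k] k) (H' : LieSubalgebra k E) (h' : IsEALA B' H')
    -- the cores of the two structures coincide (Corollary 3.2 of the paper)
    (hcores : core B H = core B' H') :
    -- `H_c = H ∩ E_c`, `H'_c = H' ∩ E_c`, and `Z(E_c)` the centre of the core: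
    let Hc : Set E := (H : Set E) ∩ (core B H : Set E)
    let Hc' : Set E := (H' : Set E) ∩ (core B H : Set E)
    let Zc : Set E := {z | z ∈ core B H ∧ ∀ w ∈ core B H, ⁅z, w⁆ = 0}
    -- hypothesis: `H_cc = H'_cc` in `E_c/Z(E_c)`
    (∀ x ∈ Hc, ∃ y ∈ Hc', x - y ∈ Zc) →
    (∀ y ∈ Hc', ∃ x ∈ Hc, y - x ∈ Zc) →
    -- (a) `H_c = H'_c`;
    Hc = Hc' ∧
    -- (b) there is an automorphism `f` of `E` fixing `E_c` pointwise with `f(H) = H'`.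
    ∃ f : E ≃ₗ⁅k⁆ E,
      (∀ x ∈ core B H, f x = x) ∧
      f '' (H : Set E) = (H' : Set E) := by
  intro Hc Hc' Zc h₁ h₂
  have hHc : ∀ t ∈ core B H, t ∈ H ↔ t ∈ H' := by
    intro t ht
    constructor
    · intro htH
      obtain ⟨y, hy, -, hz⟩ := h₁ t ⟨htH, ht⟩
      exact h.mem_of_sub_central h' htH ht hy.1 hz
    · intro htH'
      obtain ⟨x, hx, -, hz⟩ := h₂ t ⟨htH', ht⟩
      rw [hcores] at ht hz
      exact h'.mem_of_sub_central h htH' ht hx.1 hz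
  refine ⟨Set.ext fun t => and_congr_left fun ht => hHc t ht, ?_⟩
  obtain ⟨ζ, hζ⟩ := h.exists_linearMap_central h' hcores hHc
  have hζc : ∀ s ∈ H, ζ s ∈ core B H := fun s hs => h.ea4 _ (hζ s hs).1
  obtain ⟨z, hz, hzζ⟩ := h.exists_central_lie_eq ζ (fun s hs => (hζ s hs).1)
    (fun s hs => (hζ s hs).2.1) fun s hs t ht => by
      have h0 := h'.lie_eq_zero (hζ s hs).2.2 (hζ t ht).2.2
      rw [add_lie, lie_add, lie_add, h.lie_eq_zero hs ht, (hζ s hs).1 _ (hζc t ht),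
        ← lie_skew (ζ s) t] at h0
      rw [← sub_eq_zero]
      simpa [sub_eq_add_neg] using h0
  obtain ⟨f, hf⟩ := exists_lieEquiv_sub_lie (k := k) z (h.lie_lie_eq_zero_of_central hz)
    fun x y => h.lie_central hz x _ (h.lie_mem_core_of_central hz y)
  have hfH : ∀ s ∈ H, f s = s + ζ s := fun s hs => by
    rw [hf, ← hzζ s hs, ← lie_skew, sub_neg_eq_add]
  refine ⟨f, fun x hx => by rw [hf, hz x hx, sub_zero], Set.Subset.antisymm ?_ ?_⟩
  · rintro _ ⟨s, hs, rfl⟩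
    rw [hfH s hs]
    exact (hζ s hs).2.2
  · intro t ht
    have hs : h.proj 0 t ∈ H := h.mem_iff.mpr (h.proj_mem 0 t)
    refine ⟨h.proj 0 t, hs, ?_⟩
    obtain ⟨hζ₁, hζ₂, hζ₃⟩ := hζ _ hs
    set d := t - (h.proj 0 t + ζ (h.proj 0 t)) with hd
    have hdc : ∀ w ∈ core B H, ⁅d, w⁆ = 0 := fun w hw => by
      rw [hd, ← sub_sub, sub_lie, h.sub_proj_zero_central h' hcores hHc ht w hw, hζ₁ w hw,
        sub_zero]
    have hdH : d ∈ H := (hHc d (h.ea4 d hdc)).mpr (sub_mem ht hζ₃)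
    have hd0 : d = 0 := by
      rw [← h.proj_same (h.mem_iff.mp hdH), hd, map_sub, map_add, hζ₂,
        h.proj_same (h.proj_mem 0 t), add_zero, sub_self]
    rw [hfH _ hs]
    exact (sub_eq_zero.mp hd0).symm
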